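/- arXiv:1609.08322 — 2 statements merged into one kernel-verified Lean document; each statement's English description precedes it below -/
import Mathlib

section
/- Let p and q be distinct primes and let D be a group that is an internal semidirect product D = A ⋊ B of a cyclic p-group A (normal in D) and a subgroup B of order q, with [A, B] ≠ 1. If D is a section of a direct product X₁ × X₂ × ⋯ × Xₙ of finitely many locally finite groups X₁, …, Xₙ, then D is a section of Xᵢ for some i. -/
/-- `D` is a section of `X` if `D` is a homomorphic image of a subgroup of `X`. -/
def IsSection (D X : Type*) [Group D] [Group X] : Prop :=
  ∃ (K : Subgroup X) (f : K →* D), Function.Surjective f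

/-- A group is locally finite if every finitely generated subgroup is finite. -/
def IsLocallyFinite (X : Type*) [Group X] : Prop :=
  ∀ S : Subgroup X, S.FG → Finite S

theorem eq_top_of_sup_commutator_eq_top {G : Type*} [Group G] [Finite G]
    [Group.IsNilpotent G] {H : Subgroup G} (h : H ⊔ commutator G = ⊤) : H = ⊤ := by
  by_contra hH
  obtain ⟨M, hM, hHM⟩ := (eq_top_or_exists_le_coatom H).resolve_left hH
  have hMn : M.Normal := Subgroup.NormalizerCondition.normal_of_coatom M
    (Group.normalizerCondition_of_isNilpotent) hM
  have hnt : Nontrivial (G ⧸ M) := QuotientGroup.nontrivial_iff.2 hM.1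
  have hlt := Group.IsSolvable.commutator_lt_top_of_nontrivial (G ⧸ M)
  have hsup : M ⊔ commutator G = ⊤ := top_le_iff.1 (h ▸ sup_le_sup_right hHM _)
  refine hlt.ne ?_
  have h1 := congrArg (Subgroup.map (QuotientGroup.mk' M)) hsup
  rw [Subgroup.map_sup, QuotientGroup.map_mk'_self, bot_sup_eq,
    Subgroup.map_top_of_surjective _ (QuotientGroup.mk'_surjective M), commutator_def,
    Subgroup.map_commutator,
    Subgroup.map_top_of_surjective _ (QuotientGroup.mk'_surjective M)] at h1
  exact h1

/-- An eigenvalue `r` modulo `p` of multiplicative order dividing `n` lifts modulo `p ^ e`. -/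
theorem Nat.exists_modEq_pow_modEq_one {p : ℕ} [Fact p.Prime] {r n : ℕ} (h : r ^ n ≡ 1 [MOD p])
    (e : ℕ) : ∃ s, s ≡ r [MOD p] ∧ s ^ n ≡ 1 [MOD p ^ e] := by
  refine ⟨r ^ p ^ e, ?_, ?_⟩
  · rw [← ZMod.natCast_eq_natCast_iff]
    push_cast
    exact ZMod.pow_card_pow _
  · have h1 : (p : ℤ) ∣ (1 : ℤ) - (r : ℤ) ^ n := by
      have := (Nat.modEq_iff_dvd.1 h)
      exact_mod_cast this
    have h2 := dvd_sub_pow_of_dvd_sub h1 e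
    rw [Nat.modEq_iff_dvd]
    push_cast
    rw [one_pow, ← pow_mul, mul_comm n, pow_mul] at h2
    exact (pow_dvd_pow _ e.le_succ).trans h2

/-- Averaging over a coprime automorphism `φ` of an abelian `p`-group produces an element spanning a
`φ`-invariant cyclic subgroup. -/
theorem exists_eigenvector_of_iterate_eq {p : ℕ} [Fact p.Prime] {V C : Type*} [CommGroup V]
    [CommGroup C] (hV : IsPGroup p V) [Finite V] {r n : ℕ} (hn : n.Coprime p)
    (φ : V →* V) (f : V →* C) (hφ : ∀ y, φ^[n] y = y) (hf : ∀ y, f (φ y) = f y ^ r) {a : C}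
    (ha : a ∈ f.range) (hap : p ∣ orderOf a) :
    ∃ v, φ v ∈ Subgroup.zpowers v ∧ ∃ k, k.Coprime p ∧ f v = a ^ k := by
  obtain ⟨g, rfl⟩ := ha
  have hiter (k : ℕ) : f (φ^[k] g) = f g ^ r ^ k := by
    induction k with
    | zero => simp
    | succ k ih => rw [Function.iterate_succ_apply', hf, ih, ← pow_mul, pow_succ]
  have hr : r ^ n ≡ 1 [MOD p] := by
    have h1 := hiter n
    rw [hφ] at h1
    nth_rw 1 [← pow_one (f g)] at h1
    exact ((pow_eq_pow_iff_modEq.1 h1).of_dvd hap).symm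
  obtain ⟨e, he⟩ := IsPGroup.iff_card.1 hV
  obtain ⟨s, hsr, hs⟩ := Nat.exists_modEq_pow_modEq_one hr e
  have hs1 (y : V) : y ^ s ^ n = y := by
    conv_rhs => rw [← pow_one y]
    exact pow_eq_pow_iff_modEq.2 (hs.of_dvd (he ▸ orderOf_dvd_natCard y))
  refine ⟨∏ k ∈ Finset.range n, (φ^[k] g) ^ s ^ (n - k), ⟨s, ?_⟩,
    ∑ k ∈ Finset.range n, r ^ k * s ^ (n - k), ?_, ?_⟩
  · simp only [zpow_natCast, map_prod, map_pow, ← Finset.prod_pow, ← Function.iterate_succ_apply']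
    have h1 : ∀ k ∈ Finset.range n, (φ^[k.succ] g) ^ s ^ (n - k) =
        (φ^[k + 1] g) ^ s ^ (n + 1 - (k + 1)) := fun k _ => by simp
    have h2 : ∀ k ∈ Finset.range n, ((φ^[k] g) ^ s ^ (n - k)) ^ s =
        (φ^[k] g) ^ s ^ (n + 1 - k) := fun k hk => by
      rw [← pow_mul, ← pow_succ, Nat.succ_sub (Finset.mem_range.1 hk).le]
    rw [Finset.prod_congr rfl h1, Finset.prod_congr rfl h2]
    have h3 := Finset.prod_range_succ (fun k => (φ^[k] g) ^ s ^ (n + 1 - k)) n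
    rw [Finset.prod_range_succ'] at h3
    have h4 : (φ^[n] g) ^ s ^ (n + 1 - n) = (φ^[0] g) ^ s ^ (n + 1 - 0) := by
      simp [hφ, pow_succ, pow_mul, hs1]
    rw [h4] at h3
    exact (mul_right_cancel h3).symm
  · have h1 : ∑ k ∈ Finset.range n, r ^ k * s ^ (n - k) ≡ n [MOD p] := by
      rw [← ZMod.natCast_eq_natCast_iff] at hr hsr ⊢
      push_cast at hr hsr ⊢
      rw [hsr, Finset.sum_congr rfl (g := fun _ => (1 : ZMod p))]
      · simp
      · intro k hk
        rw [← pow_add, Nat.add_sub_cancel' (Finset.mem_range.1 hk).le, hr]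
    exact h1.gcd_eq.trans hn
  · simp only [map_prod, map_pow, hiter, ← pow_mul, Finset.prod_pow_eq_pow_sum]

/-- A generator of a cyclic quotient, on which a coprime automorphism `φ` acts by a power map, lifts
to an element generating a `φ`-invariant cyclic subgroup. -/
theorem IsPGroup.exists_map_eq_map_mem_zpowers {p : ℕ} [Fact p.Prime] {C : Type*} [CommGroup C]
    {a : C} {m : ℕ} (ham : orderOf a = p ^ m) (hm : m ≠ 0)
    {r n : ℕ} (hn : n.Coprime p)
    (P : Type*) [Group P] [Finite P] (hP : IsPGroup p P) (φ : P →* P) (f : P →* C)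
    (hφ : ∀ y, φ^[n] y = y) (hf : ∀ y, f (φ y) = f y ^ r) (haf : a ∈ f.range) :
    ∃ g, f g = a ∧ φ g ∈ Subgroup.zpowers g := by
  induction hN : Nat.card P using Nat.strong_induction_on generalizing P with
  | _ N ih =>
  subst hN
  let ψ : Abelianization P →* Abelianization P := Abelianization.map φ
  let F : Abelianization P →* C := Abelianization.lift f
  have hψ : ∀ y, ψ^[n] y = y := fun y => by
    induction y using QuotientGroup.induction_on with
    | H y =>
    have (k : ℕ) : ψ^[k] (Abelianization.of y) = Abelianization.of (φ^[k] y) := by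
      induction k with
      | zero => rfl
      | succ k ih => rw [Function.iterate_succ_apply', ih, Function.iterate_succ_apply']; rfl
    exact (this n).trans (congrArg _ (hφ y))
  have hF : ∀ y, F (ψ y) = F y ^ r := fun y => by
    induction y using QuotientGroup.induction_on with
    | H y => exact hf y
  obtain ⟨v, hv, k, hk, hvk⟩ := exists_eigenvector_of_iterate_eq (a := a)
    (hP.to_quotient (commutator P)) hn ψ F hψ hF
    (by obtain ⟨y, hy⟩ := haf; exact ⟨Abelianization.of y, hy⟩)
    (ham ▸ dvd_pow_self p hm)
  obtain ⟨y, rfl⟩ : ∃ y, Abelianization.of y = v := QuotientGroup.mk_surjective v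
  have hy : f y = a ^ k := hvk
  obtain ⟨c, hc⟩ : ∃ c : ℕ, f (y ^ c) = a := by
    obtain ⟨c, hc⟩ := exists_pow_eq_self_of_coprime (x := a) (n := k)
      (by rw [ham]; exact hk.pow_right m)
    exact ⟨c, by rw [map_pow, hy, hc]⟩
  let Q : Subgroup P := (Subgroup.zpowers (Abelianization.of y)).comap Abelianization.of
  have hyQ : y ∈ Q := Subgroup.mem_zpowers _
  have hφQ : ∀ z : Q, φ z ∈ Q := by
    rintro ⟨z, i, hi⟩
    change ψ (Abelianization.of z) ∈ Subgroup.zpowers (Abelianization.of y)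
    rw [← hi]
    simp only [map_zpow]
    exact zpow_mem hv i
  by_cases hQ : Q = ⊤
  · have hsup : Subgroup.zpowers y ⊔ commutator P = ⊤ := by
      rw [eq_top_iff]
      intro z _
      obtain ⟨i, hi⟩ : z ∈ Q := hQ ▸ Subgroup.mem_top z
      have : (y ^ i)⁻¹ * z ∈ commutator P := by
        apply QuotientGroup.eq.1
        exact hi
      rw [← mul_inv_cancel_left (y ^ i) z]
      exact Subgroup.mul_mem_sup ⟨i, rfl⟩ this
    have := hP.isNilpotent
    have htop := eq_top_of_sup_commutator_eq_top hsup
    refine ⟨y ^ c, hc, ?_⟩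
    obtain ⟨i, hi⟩ : φ y ∈ Subgroup.zpowers y := htop ▸ Subgroup.mem_top _
    refine ⟨i, ?_⟩
    simp only at hi ⊢
    rw [map_pow, ← hi, ← zpow_natCast, ← zpow_natCast, zpow_comm]
  · have hlt : Nat.card Q < Nat.card P := by
      refine lt_of_le_of_ne (Subgroup.card_le_card_group Q) fun h => hQ (Subgroup.eq_top_of_card_eq Q h)
    let φQ : Q →* Q := (φ.comp Q.subtype).codRestrict Q hφQ
    have hit (k : ℕ) (z : Q) : ((φQ^[k] z : Q) : P) = φ^[k] z := by
      induction k with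
      | zero => rfl
      | succ k ih => rw [Function.iterate_succ_apply', Function.iterate_succ_apply', ← ih]; rfl
    obtain ⟨g, hg, i, hi⟩ := ih _ hlt Q (hP.to_subgroup Q) φQ (f.comp Q.subtype)
      (fun z => Subtype.ext ((hit n z).trans (hφ z))) (fun z => hf z)
      ⟨⟨y ^ c, pow_mem hyQ c⟩, hc⟩ rfl
    exact ⟨g, hg, i, congrArg Subtype.val hi⟩

/-- A subgroup of `G × D` projecting onto `D` that meets `1 × D` trivially exhibits `D` as a
section of `G`. -/
theorem IsSection.of_subgroup_prod {G D : Type*} [Group G] [Group D] (S : Subgroup (G × D))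
    (hS : ∀ y ∈ S, y.1 = 1 → y.2 = 1) (hD : ∀ d, ∃ y ∈ S, y.2 = d) : IsSection D G := by
  have hinj : Function.Injective ((MonoidHom.fst G D).comp S.subtype) := by
    rw [injective_iff_map_eq_one]
    intro y hy
    exact Subtype.ext (Prod.ext hy (hS y y.2 hy))
  refine ⟨_, ((MonoidHom.snd G D).comp S.subtype).comp
    (MonoidHom.ofInjective hinj).symm.toMonoidHom, fun d => ?_⟩
  obtain ⟨y, hy, rfl⟩ := hD d
  exact ⟨MonoidHom.ofInjective hinj ⟨y, hy⟩, by simp⟩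

theorem conj_pow_eq_pow_pow {G : Type*} [Group G] {g x : G} {s : ℕ} (h : x * g * x⁻¹ = g ^ s)
    (k : ℕ) : x ^ k * g * (x ^ k)⁻¹ = g ^ s ^ k := by
  induction k with
  | zero => simp
  | succ k ih =>
    calc x ^ (k + 1) * g * (x ^ (k + 1))⁻¹ = x * (x ^ k * g * (x ^ k)⁻¹) * x⁻¹ := by group
      _ = g ^ s ^ (k + 1) := by rw [ih, ← conj_pow, h, ← pow_mul, pow_succ']

theorem conj_eq_self_iff_commute {G : Type*} [Group G] {g x : G} :
    x * g * x⁻¹ = g ↔ Commute x g := mul_inv_eq_iff_eq_mul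

/-- A metacyclic Frobenius group is a section of any group containing elements `g`, `x` with the
same conjugation relation and with the order of `g` large enough. -/
theorem isSection_of_conj_eq_pow {p q m : ℕ} [Fact p.Prime] [Fact q.Prime]
    {D G : Type*} [Group D] [Group G] {a b : D} {s : ℕ} (ham : orderOf a = p ^ m)
    (hbq : orderOf b = q) (hab : b * a * b⁻¹ = a ^ s) (hnc : ¬ Commute b a)
    (hs : (s - 1 : ℤ).gcd p = 1)
    (hD : Subgroup.zpowers a ⊔ Subgroup.zpowers b = ⊤)
    {g x : G} (hg : IsOfFinOrder g) (hpg : p ^ m ∣ orderOf g) (hxg : x * g * x⁻¹ = g ^ s) :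
    IsSection D G := by
  have ha : IsOfFinOrder a := orderOf_pos_iff.1 (ham ▸ pow_pos (Fact.out : p.Prime).pos m)
  let u : G × D := (g, a)
  let v : G × D := (x, b)
  have huv : v * u * v⁻¹ = u ^ s := Prod.ext hxg hab
  have hu : Finite (Subgroup.zpowers u : Set (G × D)) :=
    (hg.prod_mk ha).finite_zpowers
  have hN : Subgroup.zpowers v ≤ Subgroup.normalizer (Subgroup.zpowers u : Set (G × D)) := by
    rw [Subgroup.zpowers_le]
    refine Subgroup.mem_normalizer_fintype ?_
    rintro _ ⟨i, rfl⟩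
    refine ⟨s * i, ?_⟩
    simp only
    rw [← conj_zpow, huv, zpow_mul, zpow_natCast]
  refine IsSection.of_subgroup_prod (Subgroup.zpowers v ⊔ Subgroup.zpowers u) ?_ ?_
  · intro y hy hy1
    rw [← SetLike.mem_coe, Subgroup.coe_mul_of_left_le_normalizer_right _ _ hN] at hy
    obtain ⟨_, ⟨j, rfl⟩, _, ⟨i, rfl⟩, rfl⟩ := hy
    change x ^ j * g ^ i = 1 at hy1
    change b ^ j * a ^ i = 1
    have hai : a ^ i = 1 := by
      have h1 : x * g ^ i * x⁻¹ = g ^ i := by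
        rw [conj_eq_self_iff_commute, eq_inv_of_mul_eq_one_right hy1]
        exact ((Commute.refl x).zpow_right j).inv_right
      rw [← conj_zpow, hxg, ← zpow_natCast, ← zpow_mul, zpow_eq_zpow_iff_modEq] at h1
      have h2 : ((p ^ m : ℕ) : ℤ) ∣ (s - 1) * i := by
        have := (Int.natCast_dvd_natCast.2 hpg).trans h1.symm.dvd
        rwa [sub_mul, one_mul]
      rw [← orderOf_dvd_iff_zpow_eq_one, ham]
      refine IsCoprime.dvd_of_dvd_mul_left ?_ h2
      push_cast
      exact (Int.isCoprime_iff_gcd_eq_one.2 hs).symm.pow_left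
    have hcx : Commute (x ^ j.natAbs) g := by
      have h1 : Commute (x ^ j) g := by
        rw [eq_inv_of_mul_eq_one_left hy1]
        exact ((Commute.refl g).zpow_left i).inv_left
      rw [← zpow_natCast]
      rcases Int.natAbs_eq j with h | h
      · rwa [← h]
      · rw [h] at h1
        simpa using h1
    have hcb : Commute (b ^ j.natAbs) a := by
      have h1 := conj_eq_self_iff_commute.2 hcx
      rw [conj_pow_eq_pow_pow hxg] at h1
      nth_rw 2 [← pow_one g] at h1
      rw [← conj_eq_self_iff_commute, conj_pow_eq_pow_pow hab]
      nth_rw 2 [← pow_one a]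
      exact pow_eq_pow_iff_modEq.2 ((pow_eq_pow_iff_modEq.1 h1).of_dvd (ham ▸ hpg))
    have hbj : q ∣ j.natAbs := by
      by_contra hq
      have hcop : (orderOf b).Coprime j.natAbs := by
        rw [hbq]; exact ((Fact.out : q.Prime).coprime_iff_not_dvd).2 hq
      obtain ⟨c, hc⟩ := exists_pow_eq_self_of_coprime hcop.symm
      exact hnc (hc ▸ hcb.pow_left c)
    rw [hai, mul_one, ← orderOf_dvd_iff_zpow_eq_one, hbq]
    exact Int.natCast_dvd.2 hbj
  · intro d
    have hd : d ∈ (Subgroup.zpowers v ⊔ Subgroup.zpowers u).map (MonoidHom.snd G D) := by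
      rw [Subgroup.map_sup, MonoidHom.map_zpowers, MonoidHom.map_zpowers, sup_comm]
      exact hD ▸ Subgroup.mem_top d
    exact hd

/-- The generators `a`, `b` lift along a homomorphism from a finite group to elements `g`, `x` such
that `x` conjugates `g` into `zpowers g`. -/
theorem exists_lift_conj_mem_zpowers {p q m : ℕ} [Fact p.Prime] [Fact q.Prime] (hpq : p ≠ q)
    {D K : Type*} [Group D] [Group K] [Finite K] {a b : D} {r : ℕ} (ham : orderOf a = p ^ m)
    (hm : m ≠ 0) (hbq : orderOf b = q) (hab : b * a * b⁻¹ = a ^ r)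
    (hA : (Subgroup.zpowers a).Normal) (f : K →* D) (ha : a ∈ f.range) (hb : b ∈ f.range) :
    ∃ g x, f g = a ∧ f x = b ∧ x * g * x⁻¹ ∈ Subgroup.zpowers g := by
  have hp : p.Prime := Fact.out
  let T := (Subgroup.zpowers a).comap f
  have hTn : T.Normal := hA.comap f
  let fT : T →* Subgroup.zpowers a := (f.comp T.subtype).codRestrict _ fun t => t.2
  have hfT : Function.Surjective fT := by
    rintro ⟨_, i, rfl⟩
    obtain ⟨k, rfl⟩ := ha
    exact ⟨⟨k ^ i, i, by simp⟩, Subtype.ext (map_zpow f k i)⟩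
  have hAp : IsPGroup p (Subgroup.zpowers a) := by
    have : Finite (Subgroup.zpowers a) := Finite.of_surjective fT hfT
    exact IsPGroup.of_card (n := m) (by rw [Nat.card_zpowers, ham])
  obtain ⟨P₀⟩ : Nonempty (Sylow p T) := inferInstance
  have hP₀ : P₀.map fT = ⊤ := by
    have h1 := (P₀.mapSurjective hfT).is_maximal' (Q := ⊤) (hAp.to_subgroup ⊤) le_top
    exact h1.symm
  let P : Subgroup K := P₀.map T.subtype
  have hPp : IsPGroup p P := P₀.2.map T.subtype
  have hPA : ∀ z ∈ Subgroup.zpowers a, ∃ y ∈ P, f y = z := by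
    intro z hz
    obtain ⟨t, ht, h⟩ : (⟨z, hz⟩ : Subgroup.zpowers a) ∈ P₀.map fT := hP₀ ▸ Subgroup.mem_top _
    exact ⟨t, ⟨t, ht, rfl⟩, congrArg Subtype.val h⟩
  have hPT : ∀ y ∈ P, f y ∈ Subgroup.zpowers a := by
    rintro _ ⟨t, _, rfl⟩
    exact t.2
  obtain ⟨x₀, hx₀, hfx₀⟩ : ∃ x ∈ Subgroup.normalizer (P : Set K), f x = b := by
    obtain ⟨k, hk⟩ := hb
    have hkt : k ∈ Subgroup.normalizer (P : Set K) ⊔ T :=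
      (Sylow.normalizer_sup_eq_top P₀).symm ▸ Subgroup.mem_top k
    rw [← SetLike.mem_coe, Subgroup.mul_normal] at hkt
    obtain ⟨y, hy, t, ht, rfl⟩ := hkt
    obtain ⟨z, hz, hzt⟩ := hPA (f t) ht
    exact ⟨y * z, mul_mem hy (Subgroup.le_normalizer hz), by
      rw [map_mul, hzt, ← map_mul]; exact hk⟩
  obtain ⟨e, n, hn, hen⟩ := Nat.exists_eq_pow_mul_and_not_dvd (orderOf_pos x₀).ne' p hp.ne_one
  obtain ⟨c, hc⟩ : ∃ c, (b ^ p ^ e) ^ c = b := by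
    refine exists_pow_eq_self_of_coprime ?_
    rw [hbq]
    exact ((Nat.coprime_primes hp Fact.out).2 hpq).pow_left e
  let x := x₀ ^ (p ^ e * c)
  have hx : x ∈ Subgroup.normalizer (P : Set K) := pow_mem hx₀ _
  have hfx : f x = b := by rw [map_pow, hfx₀, pow_mul, hc]
  have hxn : x ^ n = 1 := by
    rw [← pow_mul, mul_right_comm, ← hen, pow_mul, pow_orderOf_eq_one, one_pow]
  let φ : P →* P := (P.normalizerMonoidHom ⟨x, hx⟩).toMonoidHom
  have hφ (y : P) : ((φ y : P) : K) = x * y * x⁻¹ := rfl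
  have hφk (k : ℕ) (y : P) : ((φ^[k] y : P) : K) = x ^ k * y * (x ^ k)⁻¹ := by
    induction k with
    | zero => simp
    | succ k ih =>
      rw [Function.iterate_succ_apply', hφ, ih]
      group
  let F : P →* Subgroup.zpowers a := (f.comp P.subtype).codRestrict _ fun y => hPT y y.2
  let : CommGroup (Subgroup.zpowers a) := IsCyclic.commGroup
  obtain ⟨g, hg, i, hi⟩ := IsPGroup.exists_map_eq_map_mem_zpowers (p := p) (m := m)
    (a := (⟨a, Subgroup.mem_zpowers a⟩ : Subgroup.zpowers a))
    ((Subgroup.orderOf_mk a _).trans ham) hm (r := r)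
    (n := n) ((hp.coprime_iff_not_dvd.2 hn).symm) P hPp φ F
    (fun y => Subtype.ext (by rw [hφk, hxn]; simp)) (fun y => by
      apply Subtype.ext
      change f (x * y * x⁻¹) = f y ^ r
      obtain ⟨i, hi⟩ := hPT y y.2
      simp only at hi
      rw [map_mul, map_mul, map_inv, hfx, ← hi, ← conj_zpow, hab, ← zpow_natCast, zpow_comm]
      simp) (by
      obtain ⟨y, hy, h⟩ := hPA a (Subgroup.mem_zpowers a)
      exact ⟨⟨y, hy⟩, Subtype.ext h⟩)
  exact ⟨g, x, congrArg Subtype.val hg, hfx, i, congrArg Subtype.val hi⟩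

theorem Subgroup.FG.map_monoidHom {G H : Type*} [Group G] [Group H] {S : Subgroup G} (hS : S.FG)
    (f : G →* H) : (S.map f).FG :=
  (Subgroup.fg_iff_submonoid_fg _).2 (((Subgroup.fg_iff_submonoid_fg _).1 hS).map f)

theorem IsLocallyFinite.pi {ι : Type*} [Finite ι] {X : ι → Type*} [∀ i, Group (X i)]
    (hX : ∀ i, IsLocallyFinite (X i)) : IsLocallyFinite (∀ i, X i) := by
  intro S hS
  have hfin (i : ι) : Finite (S.map (Pi.evalMonoidHom X i)) := hX i _ (hS.map_monoidHom _)
  refine Finite.of_injective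
    (β := ∀ i, S.map (Pi.evalMonoidHom X i)) (fun y i => ⟨y.1 i, y, y.2, rfl⟩) ?_
  intro y z h
  exact Subtype.ext (funext fun i => congrArg Subtype.val (congrFun h i))

theorem kovacs_dihedral_finite_product {p q : ℕ} (hp : p.Prime) (hq : q.Prime)
    (hpq : p ≠ q)
    {D : Type*} [Group D] (A B : Subgroup D) (hAnorm : A.Normal)
    (hAcyc : IsCyclic A) (hAp : IsPGroup p A) (hBq : Nat.card B = q)
    (hint : A ⊓ B = ⊥) (hjoin : A ⊔ B = ⊤) (hcomm : ⁅A, B⁆ ≠ ⊥)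
    {n : ℕ} (X : Fin n → Type*) [∀ i, Group (X i)]
    (hX : ∀ i, IsLocallyFinite (X i))
    (hsec : IsSection D (∀ i, X i)) :
    ∃ i, IsSection D (X i) := by
  have : Fact p.Prime := ⟨hp⟩
  have : Fact q.Prime := ⟨hq⟩
  obtain ⟨a, rfl⟩ := Subgroup.isCyclic_iff_exists_zpowers_eq_top A |>.1 hAcyc
  have : IsCyclic B := isCyclic_of_prime_card hBq
  obtain ⟨b, rfl⟩ := Subgroup.isCyclic_iff_exists_zpowers_eq_top B |>.1 this
  rw [Nat.card_zpowers] at hBq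
  obtain ⟨m, ham⟩ : ∃ m, orderOf a = p ^ m := by
    obtain ⟨m, hm⟩ := IsPGroup.iff_orderOf.1 hAp ⟨a, Subgroup.mem_zpowers a⟩
    exact ⟨m, by rwa [Subgroup.orderOf_mk] at hm⟩
  have hnc : ¬ Commute b a := by
    intro h
    refine hcomm (Subgroup.commutator_eq_bot_iff_le_centralizer.2 ?_)
    rw [Subgroup.zpowers_le, Subgroup.mem_centralizer_iff]
    rintro _ ⟨i, rfl⟩
    exact h.zpow_left i
  have hm : m ≠ 0 := by
    rintro rfl
    rw [pow_zero, orderOf_eq_one_iff] at ham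
    exact hnc (ham ▸ Commute.one_right b)
  have hafin : IsOfFinOrder a := orderOf_pos_iff.1 (ham ▸ pow_pos hp.pos m)
  have hconj : b * a * b⁻¹ ∈ Subgroup.zpowers a := hAnorm.conj_mem a (Subgroup.mem_zpowers a) b
  obtain ⟨r, hr⟩ := hafin.mem_powers_iff_mem_zpowers.2 hconj
  have hab : b * a * b⁻¹ = a ^ r := hr.symm
  obtain ⟨K, f, hf⟩ := hsec
  obtain ⟨ka, hka⟩ := hf a
  obtain ⟨kb, hkb⟩ := hf b
  let L : Subgroup K := Subgroup.closure {ka, kb}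
  have hL : Finite L := by
    have hLfg : (L.map K.subtype).FG :=
      ((Subgroup.fg_iff L).2 ⟨_, rfl, Set.toFinite _⟩).map_monoidHom _
    have := IsLocallyFinite.pi hX _ hLfg
    exact Finite.of_equiv _ (L.equivMapOfInjective _ K.subtype_injective).symm.toEquiv
  obtain ⟨g, x, hfg, hfx, hgx⟩ := exists_lift_conj_mem_zpowers hpq ham hm hBq hab hAnorm
    (f.comp L.subtype) ⟨⟨ka, Subgroup.subset_closure (by simp)⟩, hka⟩
    ⟨⟨kb, Subgroup.subset_closure (by simp)⟩, hkb⟩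
  obtain ⟨s, hs⟩ := (isOfFinOrder_of_finite g).mem_powers_iff_mem_zpowers.2 hgx
  have hxg : x * g * x⁻¹ = g ^ s := hs.symm
  have habs : b * a * b⁻¹ = a ^ s := by
    rw [← hfg, ← hfx, ← map_inv, ← map_mul, ← map_mul, hxg, map_pow]
  have hs1 : (s - 1 : ℤ).gcd p = 1 := by
    rw [Int.gcd_comm, ← Int.isCoprime_iff_gcd_eq_one,
      (Nat.prime_iff_prime_int.1 hp).coprime_iff_not_dvd]
    intro h
    have h1 : a ^ s ^ p ^ m = a ^ 1 := by
      rw [pow_eq_pow_iff_modEq, ham]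
      refine Nat.ModEq.symm (Nat.modEq_iff_dvd.2 ?_)
      have h2 := dvd_sub_pow_of_dvd_sub h m
      rw [one_pow] at h2
      push_cast
      exact (pow_dvd_pow _ m.le_succ).trans h2
    rw [← conj_pow_eq_pow_pow habs, pow_one, conj_eq_self_iff_commute] at h1
    obtain ⟨c, hc⟩ := exists_pow_eq_self_of_coprime (x := b) (n := p ^ m)
      (by rw [hBq]; exact ((Nat.coprime_primes hp hq).2 hpq).pow_left m)
    exact hnc (hc ▸ h1.pow_left c)
  have hpg : p ^ m ∣ orderOf ((g : K) : ∀ i, X i) := by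
    rw [Subgroup.orderOf_coe, Subgroup.orderOf_coe, ← ham, ← hfg]
    exact orderOf_map_dvd _ g
  have hgfin : IsOfFinOrder ((g : K) : ∀ i, X i) := by
    rw [← orderOf_pos_iff, Subgroup.orderOf_coe, Subgroup.orderOf_coe]
    exact orderOf_pos g
  have hxgX : ((x : K) : ∀ i, X i) * (g : K) * ((x : K) : ∀ i, X i)⁻¹ =
      ((g : K) : ∀ i, X i) ^ s := congrArg (fun y : L => ((y : K) : ∀ i, X i)) hxg
  generalize ((g : K) : ∀ i, X i) = g' at *
  generalize ((x : K) : ∀ i, X i) = x' at *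
  obtain ⟨i, hi⟩ : ∃ i, p ^ m ∣ orderOf (g' i) := by
    have hfo (i : Fin n) : orderOf (g' i) ≠ 0 :=
      ((Pi.evalMonoidHom X i).isOfFinOrder hgfin).orderOf_pos.ne'
    rw [hp.pow_dvd_iff_le_factorization hgfin.orderOf_pos.ne', Pi.orderOf,
      Finset.factorization_lcm fun i _ => hfo i, Finset.le_sup_iff (Nat.pos_of_ne_zero hm)] at hpg
    obtain ⟨i, -, hi⟩ := hpg
    exact ⟨i, (hp.pow_dvd_iff_le_factorization (hfo i)).2 hi⟩
  exact ⟨i, isSection_of_conj_eq_pow ham hBq habs hnc hs1 hjoin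
    ((Pi.evalMonoidHom X i).isOfFinOrder hgfin) hi (congrFun hxgX i)⟩
end

section
/- Let p and q be distinct primes and let D be a group that is an internal semidirect product D = A ⋊ B of a cyclic p-group A (normal in D) and a subgroup B of order q, with [A, B] ≠ 1. Then the centralizer of B in A is trivial: C_A(B) = 1. -/
/-- If a prime `p ≠ q` divides `k - 1`, every power of `p` dividing `k ^ q - 1` divides
`k - 1`. -/
theorem Int.prime_pow_dvd_sub_one_of_dvd_pow_sub_one {p q n : ℕ} (hp : p.Prime) (hq : q.Prime)
    (hpq : p ≠ q) {k : ℤ} (hk : (p : ℤ) ∣ k - 1) (h : (p : ℤ) ^ n ∣ k ^ q - 1) :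
    (p : ℤ) ^ n ∣ k - 1 := by
  have hpi : Prime (p : ℤ) := Nat.prime_iff_prime_int.mp hp
  rw [← geom_sum_mul] at h
  refine hpi.pow_dvd_of_dvd_mul_left n (fun hd => ?_) h
  have hmod : ∑ i ∈ Finset.range q, k ^ i ≡ q [ZMOD p] := by
    have hk1 : k ≡ 1 [ZMOD p] := (Int.modEq_iff_dvd.mpr hk).symm
    have hsum : ∑ i ∈ Finset.range q, k ^ i ≡ ∑ i ∈ Finset.range q, 1 [ZMOD p] :=
      Int.ModEq.sum fun i _ => by simpa using hk1.pow i
    simpa using hsum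
  have hpq_dvd : (p : ℤ) ∣ q := (Int.ModEq.dvd_iff hmod).mp hd
  exact hpq ((Nat.prime_dvd_prime_iff_eq hp hq).mp (by exact_mod_cast hpq_dvd))

/-- If conjugation by `b` raises `g` to the power `k`, then conjugation by `b ^ i` raises `g` to
the power `k ^ i`. -/
theorem conj_pow_eq_zpow_pow {G : Type*} [Group G] {b g : G} {k : ℤ}
    (h : b * g * b⁻¹ = g ^ k) (i : ℕ) : b ^ i * g * (b ^ i)⁻¹ = g ^ (k ^ i) := by
  induction i with
  | zero => simp
  | succ i ih =>
    calc b ^ (i + 1) * g * (b ^ (i + 1))⁻¹ = b * (b ^ i * g * (b ^ i)⁻¹) * b⁻¹ := by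
          rw [pow_succ']; group
      _ = g ^ (k ^ (i + 1)) := by
          rw [ih, ← conj_zpow, h, ← zpow_mul, pow_succ']

/-- An element `b` with `b ^ q = 1`, `q` prime, that normalizes a cyclic `p`-group with `p ≠ q` and
commutes with one of its nontrivial elements centralizes the group. -/
theorem commute_of_conj_eq_zpow_of_commute_zpow {G : Type*} [Group G] {p q n : ℕ}
    (hp : p.Prime) (hq : q.Prime) (hpq : p ≠ q) {b g : G} {k m : ℤ} (hg : orderOf g = p ^ n)
    (hb : b ^ q = 1) (hk : b * g * b⁻¹ = g ^ k) (hm : g ^ m ≠ 1) (hbm : Commute b (g ^ m)) :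
    Commute b g := by
  have hpi : Prime (p : ℤ) := Nat.prime_iff_prime_int.mp hp
  have hdvd (j : ℤ) : g ^ j = 1 ↔ (p : ℤ) ^ n ∣ j := by
    rw [← orderOf_dvd_iff_zpow_eq_one, hg, Nat.cast_pow]
  have hkq : (p : ℤ) ^ n ∣ k ^ q - 1 := by
    have h := conj_pow_eq_zpow_pow hk q
    rw [hb] at h
    rw [← hdvd, zpow_sub, ← h]
    simp
  have hkm : (p : ℤ) ^ n ∣ (k - 1) * m := by
    have h : g ^ (k * m) = g ^ m := by
      rw [zpow_mul, ← hk, conj_zpow, hbm.eq, mul_inv_cancel_right]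
    rw [← hdvd, sub_mul, zpow_sub, h, one_mul, mul_inv_cancel]
  have hpk : (p : ℤ) ∣ k - 1 := by
    by_contra hnot
    exact hm ((hdvd m).mpr (hpi.pow_dvd_of_dvd_mul_left n hnot hkm))
  have hk1 := (hdvd _).mpr (Int.prime_pow_dvd_sub_one_of_dvd_pow_sub_one hp hq hpq hpk hkq)
  rw [zpow_sub, zpow_one, mul_inv_eq_one, ← hk] at hk1
  exact mul_inv_eq_iff_eq_mul.mp hk1

theorem centralizer_of_B_in_A_trivial {p q : ℕ} (hp : p.Prime) (hq : q.Prime)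
    (hpq : p ≠ q)
    {D : Type*} [Group D] (A B : Subgroup D) (hAnorm : A.Normal)
    (hAcyc : IsCyclic A) (hAp : IsPGroup p A) (hBq : Nat.card B = q)
    (hint : A ⊓ B = ⊥) (hjoin : A ⊔ B = ⊤) (hcomm : ⁅A, B⁆ ≠ ⊥) :
    A ⊓ Subgroup.centralizer (B : Set D) = ⊥ := by
  have : Fact p.Prime := ⟨hp⟩
  rw [Subgroup.eq_bot_iff_forall]
  rintro x ⟨hxA, hxB⟩
  by_contra hx
  apply hcomm
  obtain ⟨g, rfl⟩ := A.isCyclic_iff_exists_zpowers_eq_top.mp hAcyc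
  obtain ⟨m, rfl⟩ := Subgroup.mem_zpowers_iff.mp hxA
  obtain ⟨n, hn⟩ := IsPGroup.iff_orderOf.mp hAp ⟨g, Subgroup.mem_zpowers g⟩
  rw [Subgroup.orderOf_mk] at hn
  rw [Subgroup.commutator_eq_bot_iff_le_centralizer, Subgroup.zpowers_le,
    Subgroup.mem_centralizer_iff]
  intro b hb
  obtain ⟨k, hk⟩ := Subgroup.mem_zpowers_iff.mp (hAnorm.conj_mem g (Subgroup.mem_zpowers g) b)
  have hbq : b ^ q = 1 := by
    rw [← hBq]
    exact congrArg Subtype.val (pow_card_eq_one' (x := (⟨b, hb⟩ : B)))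
  exact commute_of_conj_eq_zpow_of_commute_zpow hp hq hpq hn hbq hk.symm hx
    (Subgroup.mem_centralizer_iff.mp hxB b hb)
end
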